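/- The binary Rosenthal number ros_01 is equal to the reaping number 𝔯. -/

import Mathlib

/-- A *binary Rosenthal family*: a family of infinite subsets of `ℕ` such that for every
fixed-point-free `f : ℕ → ℕ` there is `A` in the family with `f[A] ∩ A = ∅`. -/
def IsBinaryRosenthalFamily (F : Set (Set ℕ)) : Prop :=
  (∀ A ∈ F, A.Infinite) ∧
    ∀ f : ℕ → ℕ, (∀ n, f n ≠ n) → ∃ A ∈ F, f '' A ∩ A = ∅

/-- The binary Rosenthal number `ros_01`: the minimal cardinality of a binary Rosenthal
family. -/
noncomputable def binaryRosenthalNumber : Cardinal :=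
  sInf {c | ∃ F : Set (Set ℕ), IsBinaryRosenthalFamily F ∧ Cardinal.mk F = c}

/-- The reaping number `𝔯`: the minimal cardinality of a family `F` of infinite subsets of
`ℕ` such that no single `X ⊆ ℕ` splits all members of `F` (i.e. there is no `X` with both
`A ∩ X` and `A \ X` infinite for all `A ∈ F`). -/
noncomputable def reapingNumber : Cardinal :=
  sInf {c | ∃ F : Set (Set ℕ), (∀ A ∈ F, A.Infinite) ∧
    (¬ ∃ X : Set ℕ, ∀ A ∈ F, (A ∩ X).Infinite ∧ (A \ X).Infinite) ∧ Cardinal.mk F = c}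

open Cardinal Filter

/-- A reaping family: a family of infinite subsets of `ℕ` not split by a single set. -/
def IsReapingFamily (F : Set (Set ℕ)) : Prop :=
  (∀ A ∈ F, A.Infinite) ∧ ¬ ∃ X : Set ℕ, ∀ A ∈ F, (A ∩ X).Infinite ∧ (A \ X).Infinite

theorem reapingNumber_eq_sInf :
    reapingNumber = sInf {c | ∃ F : Set (Set ℕ), IsReapingFamily F ∧ Cardinal.mk F = c} := by
  simp only [reapingNumber, IsReapingFamily, and_assoc]

theorem isReapingFamily_setOf_infinite : IsReapingFamily {A : Set ℕ | A.Infinite} := by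
  refine ⟨fun _ h => h, ?_⟩
  rintro ⟨X, hX⟩
  have h : X.Infinite := by simpa using (hX Set.univ Set.infinite_univ).1
  simpa using (hX X h).2

theorem exists_split_of_mk_lt_reapingNumber {F : Set (Set ℕ)} (hF : ∀ A ∈ F, A.Infinite)
    (hlt : Cardinal.mk F < reapingNumber) :
    ∃ X : Set ℕ, ∀ A ∈ F, (A ∩ X).Infinite ∧ (A \ X).Infinite := by
  by_contra h
  rw [reapingNumber_eq_sInf] at hlt
  exact hlt.not_ge (csInf_le' ⟨F, ⟨hF, h⟩, rfl⟩)

theorem exists_split_of_countable {F : Set (Set ℕ)} (hF : ∀ A ∈ F, A.Infinite)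
    (hc : F.Countable) : ∃ X : Set ℕ, ∀ A ∈ F, (A ∩ X).Infinite ∧ (A \ X).Infinite := by
  rcases F.eq_empty_or_nonempty with rfl | hne
  · simp
  obtain ⟨e, rfl⟩ := hc.exists_eq_range hne
  have hfreq : ∀ n : ℕ, ∃ᶠ k in atTop, k ∈ e n.unpair.1 := fun n =>
    Nat.frequently_atTop_iff_infinite.2 (hF _ ⟨_, rfl⟩)
  obtain ⟨φ, hφ, hmem⟩ := extraction_forall_of_frequently hfreq
  refine ⟨φ '' {n | Even n.unpair.2}, ?_⟩
  rintro _ ⟨i, rfl⟩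
  constructor
  · refine Set.infinite_of_injective_forall_mem (f := fun l => φ (Nat.pair i (2 * l))) ?_ ?_
    · intro l m h
      have := hφ.injective h
      simpa using this
    · intro l
      exact ⟨by simpa using hmem (Nat.pair i (2 * l)), _, by simp, rfl⟩
  · refine Set.infinite_of_injective_forall_mem (f := fun l => φ (Nat.pair i (2 * l + 1))) ?_ ?_
    · intro l m h
      have := hφ.injective h
      simpa using this
    · intro l
      refine ⟨by simpa using hmem (Nat.pair i (2 * l + 1)), ?_⟩
      rintro ⟨n, hn, h⟩
      rw [hφ.injective h] at hn
      simp at hn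

theorem IsReapingFamily.aleph0_le_mk {F : Set (Set ℕ)} (hF : IsReapingFamily F) :
    ℵ₀ ≤ Cardinal.mk F := by
  by_contra h
  exact hF.2 (exists_split_of_countable hF.1 (Cardinal.le_aleph0_iff_set_countable.1
    (not_le.1 h).le))

theorem IsReapingFamily.exists_eventually_homogeneous {F : Set (Set ℕ)}
    (hF : IsReapingFamily F) (X : Set ℕ) :
    ∃ A ∈ F, ∃ k, ∀ m ∈ A, ∀ n ∈ A, k ≤ m → k ≤ n → (m ∈ X ↔ n ∈ X) := by
  have h := hF.2
  push Not at h
  obtain ⟨A, hA, hX⟩ := h X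
  refine ⟨A, hA, ?_⟩
  by_cases hi : (A ∩ X).Infinite
  · obtain ⟨k, hk⟩ := (hX hi).bddAbove
    refine ⟨k + 1, fun m hm n hn hkm hkn => ?_⟩
    have h1 : m ∈ X := by by_contra hc; have := hk ⟨hm, hc⟩; omega
    have h2 : n ∈ X := by by_contra hc; have := hk ⟨hn, hc⟩; omega
    tauto
  · obtain ⟨k, hk⟩ := (Set.not_infinite.1 hi).bddAbove
    refine ⟨k + 1, fun m hm n hn hkm hkn => ?_⟩
    have h1 : m ∉ X := by intro hc; have := hk ⟨hm, hc⟩; omega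
    have h2 : n ∉ X := by intro hc; have := hk ⟨hn, hc⟩; omega
    tauto

/-- Parity of the number of steps for which the iterates of `f` at `n` strictly decrease `μ`. -/
def descentParity {α : Type*} (f : α → α) (μ : α → ℕ) (n : α) : Bool :=
  if μ (f n) < μ n then !(descentParity f μ (f n)) else true
termination_by μ n

theorem descentParity_of_lt {α : Type*} {f : α → α} {μ : α → ℕ} {n : α} (h : μ (f n) < μ n) :
    descentParity f μ n = !(descentParity f μ (f n)) := by
  rw [descentParity, if_pos h]

/-- The graph of `f` on the points moved upwards is bipartite. -/
theorem exists_bicoloring_of_lt_apply (f : ℕ → ℕ) :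
    ∃ c : Set ℕ, ∀ n, n < f n → (n ∈ c ↔ f n ∉ c) := by
  refine ⟨{n | ∀ᶠ N in (hyperfilter ℕ : Filter ℕ), descentParity f (fun n => N - n) n = true},
    fun n hn => ?_⟩
  simp only [Set.mem_ofPred_eq, ← Ultrafilter.eventually_not]
  refine eventually_congr (Eventually.filter_mono Nat.hyperfilter_le_atTop ?_)
  filter_upwards [eventually_gt_atTop n] with N hN
  rw [descentParity_of_lt (by omega)]
  simp

/-- A fixed-point-free `f` admits two bipartitions of `ℕ` such that no `n` has the same colours
as `f n` in both. -/
theorem exists_bipartitions_of_ne (f : ℕ → ℕ) (hf : ∀ n, f n ≠ n) :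
    ∃ D c : Set ℕ, ∀ n, (n ∈ D ↔ f n ∈ D) → ¬ (n ∈ c ↔ f n ∈ c) := by
  obtain ⟨u, hu⟩ := exists_bicoloring_of_lt_apply f
  refine ⟨{n | f n < n},
    {n | f n < n ∧ descentParity f id n = true ∨ ¬ f n < n ∧ n ∈ u}, fun n hD => ?_⟩
  simp only [Set.mem_ofPred_eq] at hD ⊢
  by_cases h : f n < n
  · have := descentParity_of_lt (f := f) (μ := id) h
    simp [h, hD.1 h, this]
  · have h' := fun hc => h (hD.2 hc)
    have := hu n (lt_of_le_of_ne (not_lt.1 h) (hf n).symm)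
    simp only [h, false_and, not_false_eq_true, true_and, false_or]
    tauto

theorem IsReapingFamily.exists_isBinaryRosenthalFamily {F : Set (Set ℕ)}
    (hF : IsReapingFamily F) :
    ∃ G : Set (Set ℕ), IsBinaryRosenthalFamily G ∧ Cardinal.mk G ≤ Cardinal.mk F := by
  let g : F × F × ℕ → Set ℕ := fun p => Nat.nth (· ∈ p.1.1) '' (p.2.1.1 \ Set.Iio p.2.2)
  have hmono : ∀ A ∈ F, StrictMono (Nat.nth (· ∈ A)) := fun A hA =>
    Nat.nth_strictMono (hF.1 A hA)
  refine ⟨Set.range g, ⟨?_, fun f hf => ?_⟩, ?_⟩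
  · rintro _ ⟨⟨A, B, k⟩, rfl⟩
    exact ((hF.1 B.1 B.2).sdiff (Set.finite_Iio k)).image (hmono A.1 A.2).injective.injOn
  · obtain ⟨D, c, hDc⟩ := exists_bipartitions_of_ne f hf
    obtain ⟨A, hA, k, hk⟩ := hF.exists_eventually_homogeneous D
    obtain ⟨B, hB, l, hl⟩ := hF.exists_eventually_homogeneous (Nat.nth (· ∈ A) ⁻¹' c)
    refine ⟨_, ⟨(⟨A, hA⟩, ⟨B, hB⟩, max k l), rfl⟩, Set.eq_empty_of_forall_notMem ?_⟩
    rintro _ ⟨⟨_, ⟨m, ⟨hmB, hm⟩, rfl⟩, rfl⟩, n, ⟨hnB, hn⟩, hnm⟩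
    simp only [Set.mem_Iio, not_lt, max_le_iff] at hm hn hnm hmB hnB
    have hmem := Nat.nth_mem_of_infinite (hF.1 A hA)
    refine hDc (Nat.nth (· ∈ A) m) ?_ ?_ <;> rw [← hnm]
    · exact hk _ (hmem m) _ (hmem n) (hm.1.trans ((hmono A hA).le_apply))
        (hn.1.trans ((hmono A hA).le_apply))
    · exact hl m hmB n hnB hm.2 hn.2
  · have h := hF.aleph0_le_mk
    refine mk_range_le.trans ?_
    simp only [mk_prod, lift_id, mk_nat]
    rw [mul_eq_left h h aleph0_ne_zero, mul_eq_self h]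

/-- A family smaller than `𝔯` admits a sequence of disjoint sets each meeting every member
infinitely often, given as the fibres of a function. -/
theorem exists_infinite_inter_fibers_of_mk_lt_reapingNumber {F : Set (Set ℕ)}
    (hF : ∀ A ∈ F, A.Infinite) (hlt : Cardinal.mk F < reapingNumber) :
    ∃ g : ℕ → ℕ, ∀ A ∈ F, ∀ i, (A ∩ g ⁻¹' {i}).Infinite := by
  classical
  let Family := {t : F → Set ℕ // ∀ A, (t A).Infinite}
  have hsplit : ∀ t : Family, ∃ X : Set ℕ, ∀ A, (t.1 A ∩ X).Infinite ∧ (t.1 A \ X).Infinite := by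
    intro t
    obtain ⟨X, hX⟩ := exists_split_of_mk_lt_reapingNumber (F := Set.range t.1)
      (by rintro _ ⟨A, rfl⟩; exact t.2 A) (mk_range_le.trans_lt hlt)
    exact ⟨X, fun A => hX _ ⟨A, rfl⟩⟩
  choose X hX using hsplit
  let T : ℕ → Family := fun i => Nat.rec ⟨fun A => A.1, fun A => hF A.1 A.2⟩
    (fun _ t => ⟨fun A => t.1 A \ X t, fun A => (hX t A).2⟩) i
  have hT : ∀ i A, (T (i + 1)).1 A = (T i).1 A \ X (T i) := fun _ _ => rfl
  have hsub : ∀ A : F, ∀ i, (T i).1 A ⊆ A.1 ∧ ∀ n ∈ (T i).1 A, ∀ j < i, n ∉ X (T j) := by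
    intro A i
    induction i with
    | zero => exact ⟨subset_rfl, fun _ _ _ h => absurd h (Nat.not_lt_zero _)⟩
    | succ i ih =>
      rw [hT]
      refine ⟨Set.sdiff_subset.trans ih.1, fun n hn j hj => ?_⟩
      rcases Nat.lt_succ_iff_lt_or_eq.1 hj with h | rfl
      · exact ih.2 n hn.1 j h
      · exact hn.2
  refine ⟨fun n => if h : ∃ i, n ∈ X (T i) then Nat.find h else 0, fun A hA i => ?_⟩
  refine (hX (T i) ⟨A, hA⟩).1.mono ?_
  rintro n ⟨hn, hnX⟩
  refine ⟨(hsub ⟨A, hA⟩ i).1 hn, ?_⟩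
  have h : ∃ i, n ∈ X (T i) := ⟨i, hnX⟩
  simp only [Set.mem_preimage, Set.mem_singleton_iff, dif_pos h]
  exact (Nat.find_eq_iff h).2 ⟨hnX, (hsub ⟨A, hA⟩ i).2 n hn⟩

theorem IsBinaryRosenthalFamily.reapingNumber_le_mk {F : Set (Set ℕ)}
    (hF : IsBinaryRosenthalFamily F) : reapingNumber ≤ Cardinal.mk F := by
  by_contra! hlt
  obtain ⟨g, hg⟩ := exists_infinite_inter_fibers_of_mk_lt_reapingNumber hF.1 hlt
  obtain ⟨A, hA, hdisj⟩ := hF.2 (fun n => if g n = n then n + 1 else g n) (by grind)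
  obtain ⟨i, hi⟩ := (hF.1 A hA).nonempty
  obtain ⟨n, ⟨hnA, hni⟩, hin⟩ := (hg A hA i).exists_gt i
  have hni : g n = i := hni
  refine (Set.ext_iff.1 hdisj i).1 ⟨⟨n, hnA, ?_⟩, hi⟩
  grind

/-- The binary Rosenthal number `ros_01` equals the reaping number `𝔯`. -/
theorem binaryRosenthal_eq_reaping : binaryRosenthalNumber = reapingNumber := by
  have key : ∀ F, IsReapingFamily F → binaryRosenthalNumber ≤ Cardinal.mk F := by
    intro F hF
    obtain ⟨G, hG, hle⟩ := hF.exists_isBinaryRosenthalFamily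
    refine le_trans ?_ hle
    exact csInf_le' ⟨G, hG, rfl⟩
  apply le_antisymm
  · rw [reapingNumber_eq_sInf]
    refine le_csInf ⟨_, _, isReapingFamily_setOf_infinite, rfl⟩ ?_
    rintro _ ⟨F, hF, rfl⟩
    exact key F hF
  · obtain ⟨G, hG, -⟩ := isReapingFamily_setOf_infinite.exists_isBinaryRosenthalFamily
    refine le_csInf ⟨_, G, hG, rfl⟩ ?_
    rintro _ ⟨F, hF, rfl⟩
    exact hF.reapingNumber_le_mk
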